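/- Let M_p be a weight sequence satisfying (M.1), let ω : ℝ^d → (0,∞) be measurable with: for every R > 0 there is C_R > 0 such that ω(x+h) ≤ C_R ω(x) for all x ∈ ℝ^d and |h| ≤ R, and fix ℓ > 0. Let X_ℓ be the space of smooth φ : ℝ^d → ℂ with ‖φ‖_{D^{M_p,ℓ}_{L¹_ω}} < ∞ and let f : X_ℓ → ℂ be linear with ‖f‖' := sup{|⟨f,φ⟩| : φ ∈ X_ℓ, ‖φ‖_{D^{M_p,ℓ}_{L¹_ω}} ≤ 1} < ∞. Then: (a) for every smooth compactly supported φ with ‖φ‖_{E^{M_p,ℓ}(supp φ)} < ∞ there is C_φ > 0, independent of f, such that |⟨f, t ↦ φ(x−t)⟩| ≤ C_φ ‖f‖' ω(x) for all x ∈ ℝ^d; (b) for every smooth ψ with compact support and sup_{α} sup_{t} |∂^αψ(t)|/(ℓ'^{|α|}M_α) < ∞ for all ℓ' > 0, there is C_ψ > 0 with |V_ψf(x,ξ)| ≤ C_ψ ‖f‖' ω(x) e^{M(4π|ξ|/ℓ)} for all (x,ξ) ∈ ℝ^{2d}. -/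

import Mathlib

open MeasureTheory Real
open scoped BigOperators Pointwise

noncomputable section

/-- `ℝ^d` with the Euclidean norm. -/
abbrev Rd (d : ℕ) := EuclideanSpace ℝ (Fin d)

/-- Condition (M.1): a positive, logarithmically convex weight sequence. -/
def IsM1 (M : ℕ → ℝ) : Prop :=
  (∀ p, 0 < M p) ∧ ∀ p : ℕ, 1 ≤ p → (M p) ^ 2 ≤ M (p - 1) * M (p + 1)

/-- Condition (M.2)'. -/
def IsM2' (M : ℕ → ℝ) : Prop :=
  ∃ A H : ℝ, 1 ≤ A ∧ 1 ≤ H ∧ ∀ p : ℕ, M (p + 1) ≤ A * H ^ p * M p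

/-- Condition (M.2). -/
def IsM2 (M : ℕ → ℝ) : Prop :=
  ∃ A H : ℝ, 1 ≤ A ∧ 1 ≤ H ∧ ∀ p q : ℕ, M (p + q) ≤ A * H ^ (p + q) * M p * M q

/-- Condition (M.3)'. -/
def IsM3' (M : ℕ → ℝ) : Prop := Summable fun p : ℕ => M p / M (p + 1)

/-- Condition (M.3). -/
def IsM3 (M : ℕ → ℝ) : Prop :=
  IsM3' M ∧ ∃ c₀ > (0 : ℝ), ∀ q : ℕ, 1 ≤ q →
    (∑' j : ℕ, M (q + j - 1) / M (q + j)) ≤ c₀ * q * (M (q - 1) / M q)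

/-- The associated function `M(t) = sup_p log (t^p M 0 / M p)`, with `M(0) = 0`. -/
def assocFn (M : ℕ → ℝ) (t : ℝ) : ℝ :=
  if t = 0 then 0 else ⨆ p : ℕ, Real.log (t ^ p * M 0 / M p)

variable {d : ℕ}

/-- The partial derivative in the `i`-th coordinate direction. -/
def pder (i : Fin d) (f : Rd d → ℂ) : Rd d → ℂ :=
  fun x => fderiv ℝ f x (EuclideanSpace.single i 1)

/-- The multi-index partial derivative `∂^α`. -/
def mderiv (α : Fin d → ℕ) (f : Rd d → ℂ) : Rd d → ℂ :=
  (List.finRange d).foldr (fun i g => (pder i)^[α i] g) f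

/-- The order `|α|` of a multi-index. -/
def mOrd (α : Fin d → ℕ) : ℕ := ∑ i, α i

/-- The factorial `α!` of a multi-index. -/
def mFact (α : Fin d → ℕ) : ℕ := ∏ i, Nat.factorial (α i)

/-- The set of quotients defining the norm of `E^{M_p,ℓ}(K)`. -/
def ESet (M : ℕ → ℝ) (ℓ : ℝ) (K : Set (Rd d)) (φ : Rd d → ℂ) : Set ℝ :=
  {r | ∃ (α : Fin d → ℕ) (x : Rd d), x ∈ K ∧
    r = ‖mderiv α φ x‖ / (ℓ ^ mOrd α * M (mOrd α))}

/-- `‖φ‖_{E^{M_p,ℓ}(K)}`. -/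
def Enorm (M : ℕ → ℝ) (ℓ : ℝ) (K : Set (Rd d)) (φ : Rd d → ℂ) : ℝ :=
  sSup (ESet M ℓ K φ)

/-- Finiteness of `‖φ‖_{E^{M_p,ℓ}(K)}`. -/
def EnormFin (M : ℕ → ℝ) (ℓ : ℝ) (K : Set (Rd d)) (φ : Rd d → ℂ) : Prop :=
  BddAbove (ESet M ℓ K φ)

/-- Membership in the test space `D^{(M_p)}(ℝ^d)`. -/
def IsTestD (M : ℕ → ℝ) (φ : Rd d → ℂ) : Prop :=
  ContDiff ℝ (⊤ : ℕ∞) φ ∧ HasCompactSupport φ ∧ ∀ ℓ > (0 : ℝ), EnormFin M ℓ (tsupport φ) φ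

/-- `f` is a Beurling ultradistribution of class `(M_p)`. -/
def IsUltraD (M : ℕ → ℝ) (f : (Rd d → ℂ) →ₗ[ℂ] ℂ) : Prop :=
  ∀ K : Set (Rd d), IsCompact K → ∃ ℓ > (0 : ℝ), ∃ C > (0 : ℝ), ∀ φ : Rd d → ℂ,
    IsTestD M φ → tsupport φ ⊆ K → ‖f φ‖ ≤ C * Enorm M ℓ K φ

/-- Euclidean dot product. -/
def dotR (ξ t : Rd d) : ℝ := ∑ i, ξ i * t i

/-- The window `t ↦ conj(ψ(t-x)) e^{-2πi ξ·t}` of the short-time Fourier transform. -/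
def windowFn (ψ : Rd d → ℂ) (x ξ : Rd d) : Rd d → ℂ :=
  fun t => (starRingEnd ℂ) (ψ (t - x)) * Complex.exp (-(2 * Real.pi * dotR ξ t : ℝ) * Complex.I)

/-- The short-time Fourier transform of a function `φ` with respect to the window `ψ`. -/
def STFTf (ψ φ : Rd d → ℂ) (x ξ : Rd d) : ℂ := ∫ t, φ t * windowFn ψ x ξ t

/-- The short-time Fourier transform of a linear functional `f` w.r.t. the window `ψ`. -/
def STFTd (f : (Rd d → ℂ) →ₗ[ℂ] ℂ) (ψ : Rd d → ℂ) (x ξ : Rd d) : ℂ := f (windowFn ψ x ξ)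

/-- The weight condition (5): `ω(·+x)/ω(x)` locally uniformly bounded. -/
def OmegaCond (ω : Rd d → ℝ) : Prop :=
  (∀ x, 0 < ω x) ∧ Measurable ω ∧
    ∀ R > (0 : ℝ), ∃ C > (0 : ℝ), ∀ x h : Rd d, ‖h‖ ≤ R → ω (x + h) ≤ C * ω x

/-- The set of values defining `‖φ‖_{D^{M_p,ℓ}_{L¹_ω}}`. -/
def DL1Set (M : ℕ → ℝ) {d : ℕ} (ω : Rd d → ℝ) (ℓ : ℝ) (φ : Rd d → ℂ) : Set ℝ :=
  {r | ∃ α : Fin d → ℕ, r = (∫ x, ‖mderiv α φ x‖ * ω x) / (ℓ ^ mOrd α * M (mOrd α))}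

/-- `‖φ‖_{D^{M_p,ℓ}_{L¹_ω}}`. -/
def DL1norm (M : ℕ → ℝ) {d : ℕ} (ω : Rd d → ℝ) (ℓ : ℝ) (φ : Rd d → ℂ) : ℝ :=
  sSup (DL1Set M ω ℓ φ)

/-- Finiteness of `‖φ‖_{D^{M_p,ℓ}_{L¹_ω}}`. -/
def DL1Fin (M : ℕ → ℝ) {d : ℕ} (ω : Rd d → ℝ) (ℓ : ℝ) (φ : Rd d → ℂ) : Prop :=
  (∀ α : Fin d → ℕ, Integrable fun x => ‖mderiv α φ x‖ * ω x) ∧ BddAbove (DL1Set M ω ℓ φ)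

/-- The set of values defining the dual norm `‖f‖_{(D^{M_p,ℓ}_{L¹_ω})'}`. -/
def FdualSet (M : ℕ → ℝ) {d : ℕ} (ω : Rd d → ℝ) (ℓ : ℝ) (f : (Rd d → ℂ) →ₗ[ℂ] ℂ) : Set ℝ :=
  {r | ∃ φ : Rd d → ℂ, ContDiff ℝ (⊤ : ℕ∞) φ ∧ DL1Fin M ω ℓ φ ∧ DL1norm M ω ℓ φ ≤ 1 ∧ r = ‖f φ‖}

/-- The dual norm `‖f‖_{(D^{M_p,ℓ}_{L¹_ω})'}`. -/
def Fdualnorm (M : ℕ → ℝ) {d : ℕ} (ω : Rd d → ℝ) (ℓ : ℝ) (f : (Rd d → ℂ) →ₗ[ℂ] ℂ) : ℝ :=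
  sSup (FdualSet M ω ℓ f)

section PartialDerivatives

/-- The composition of the partial derivatives in the directions listed in `L`. -/
def pderList (L : List (Fin d)) (f : Rd d → ℂ) : Rd d → ℂ := L.foldr pder f

theorem ContDiff.pder {f : Rd d → ℂ} (hf : ContDiff ℝ (⊤ : ℕ∞) f) (i : Fin d) :
    ContDiff ℝ (⊤ : ℕ∞) (pder i f) :=
  (hf.fderiv_right (by simp)).clm_apply contDiff_const

theorem ContDiff.pderList {f : Rd d → ℂ} (hf : ContDiff ℝ (⊤ : ℕ∞) f) (L : List (Fin d)) :
    ContDiff ℝ (⊤ : ℕ∞) (pderList L f) := by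
  induction L with
  | nil => exact hf
  | cons i L ih => exact ih.pder i

theorem pder_comm {f : Rd d → ℂ} (hf : ContDiff ℝ (⊤ : ℕ∞) f) (i j : Fin d) :
    pder i (pder j f) = pder j (pder i f) := by
  have hd : Differentiable ℝ (fderiv ℝ f) :=
    (hf.fderiv_right (m := (⊤ : ℕ∞)) (by simp)).differentiable (by simp)
  have key : ∀ (k l : Fin d) (x : Rd d), pder k (pder l f) x =
      fderiv ℝ (fderiv ℝ f) x (EuclideanSpace.single k 1) (EuclideanSpace.single l 1) := by
    intro k l x
    unfold pder
    rw [fderiv_clm_apply hd.differentiableAt (differentiableAt_const _)]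
    simp
  funext x
  rw [key, key]
  exact (hf.contDiffAt.isSymmSndFDerivAt (by
    rw [minSmoothness_of_isRCLikeNormedField]; exact WithTop.coe_le_coe.2 le_top)) _ _

theorem pderList_perm {f : Rd d → ℂ} (hf : ContDiff ℝ (⊤ : ℕ∞) f) {L L' : List (Fin d)}
    (h : L.Perm L') : pderList L f = pderList L' f := by
  induction h with
  | nil => rfl
  | cons i _ ih => exact congrArg (pder i) ih
  | swap i j L => exact pder_comm (hf.pderList L) j i
  | trans _ _ ih₁ ih₂ => exact ih₁.trans ih₂

/-- The list in which the direction `i` is repeated `α i` times. -/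
def dirList (α : Fin d → ℕ) : List (Fin d) :=
  (List.finRange d).flatMap fun i => List.replicate (α i) i

theorem mderiv_eq_pderList (α : Fin d → ℕ) (f : Rd d → ℂ) :
    mderiv α f = pderList (dirList α) f := by
  have hrep : ∀ (n : ℕ) (i : Fin d) (g : Rd d → ℂ),
      (pder i)^[n] g = (List.replicate n i).foldr pder g := by
    intro n i g
    induction n with
    | zero => rfl
    | succ n ih => rw [Function.iterate_succ_apply', List.replicate_succ, List.foldr_cons, ih]
  simp only [mderiv, pderList, dirList, List.foldr_flatMap, hrep]

theorem count_dirList (α : Fin d → ℕ) (i : Fin d) : (dirList α).count i = α i := by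
  rw [dirList, List.count_flatMap]
  have h : (List.count i ∘ fun j => List.replicate (α j) j) = fun j => if j = i then α j else 0 := by
    funext j
    simp [List.count_replicate]
  rw [h, ← List.ofFn_eq_map, List.sum_ofFn]
  simp

theorem length_dirList (α : Fin d → ℕ) : (dirList α).length = mOrd α := by
  simp [dirList, mOrd, List.length_flatMap, ← List.ofFn_eq_map, List.sum_ofFn]

theorem exists_mderiv_eq_pderList {f : Rd d → ℂ} (hf : ContDiff ℝ (⊤ : ℕ∞) f)
    (L : List (Fin d)) : ∃ α : Fin d → ℕ, mOrd α = L.length ∧ mderiv α f = pderList L f := by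
  have h : (dirList fun i => L.count i).Perm L :=
    List.perm_iff_count.2 fun i => count_dirList _ i
  exact ⟨fun i => L.count i, by rw [← length_dirList, h.length_eq],
    by rw [mderiv_eq_pderList, pderList_perm hf h]⟩

theorem tsupport_pderList_subset (L : List (Fin d)) (f : Rd d → ℂ) :
    tsupport (pderList L f) ⊆ tsupport f := by
  induction L with
  | nil => exact subset_rfl
  | cons i L ih =>
    refine (closure_mono fun x hx => ?_).trans ((tsupport_fderiv_subset ℝ).trans ih)
    intro h0
    exact hx (by simp [pderList, pder] at h0 ⊢; simp [h0])

theorem pderList_comp_const_sub {f : Rd d → ℂ} (hf : ContDiff ℝ (⊤ : ℕ∞) f) (x : Rd d)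
    (L : List (Fin d)) :
    pderList L (fun t => f (x - t)) = fun t => (-1) ^ L.length * pderList L f (x - t) := by
  induction L with
  | nil => simp [pderList]
  | cons i L ih =>
    change pder i (pderList L fun t => f (x - t)) = _
    rw [ih]
    funext t
    have h := ((((hf.pderList L).differentiable (by simp) (x - t)).hasFDerivAt.comp t
      ((hasFDerivAt_id t).const_sub x)).const_mul ((-1 : ℂ) ^ L.length)).fderiv
    simp only [Function.comp_def] at h
    simp only [pder, h]
    simp [pow_succ, pderList, pder]

theorem pderList_conj_comp_sub {f : Rd d → ℂ} (x : Rd d) (L : List (Fin d)) :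
    pderList L (fun t => (starRingEnd ℂ) (f (t - x))) =
      fun t => (starRingEnd ℂ) (pderList L f (t - x)) := by
  induction L with
  | nil => rfl
  | cons i L ih =>
    change pder i (pderList L fun t => (starRingEnd ℂ) (f (t - x))) = _
    rw [ih]
    funext t
    have h := Complex.conjCLE.comp_fderiv (f := fun t => pderList L f (t - x)) (x := t)
    have h' : fderiv ℝ (fun t => (starRingEnd ℂ) (pderList L f (t - x))) t =
      (Complex.conjCLE : ℂ →L[ℝ] ℂ) ∘L fderiv ℝ (pderList L f) (t - x) := by
      rw [← fderiv_comp_sub (𝕜 := ℝ) (f := pderList L f) x]; exact h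
    simp only [pder, h']
    rfl

theorem pderList_add_const_mul {f g : Rd d → ℂ} (hf : ContDiff ℝ (⊤ : ℕ∞) f)
    (hg : ContDiff ℝ (⊤ : ℕ∞) g) (c : ℂ) (L : List (Fin d)) :
    pderList L (fun t => f t + c * g t) = fun t => pderList L f t + c * pderList L g t := by
  induction L with
  | nil => rfl
  | cons i L ih =>
    change pder i (pderList L fun t => f t + c * g t) = _
    rw [ih]
    funext t
    have h := (((hf.pderList L).differentiable (by simp) t).hasFDerivAt.add
      (((hg.pderList L).differentiable (by simp) t).hasFDerivAt.const_mul c)).fderiv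
    change fderiv ℝ (fun t => pderList L f t + c * pderList L g t) t = _ at h
    simp only [pder, h]
    simp [pderList, pder]

end PartialDerivatives

section LogConvexity

variable {M : ℕ → ℝ}

theorem IsM1.monotone_ratio (hM : IsM1 M) : Monotone fun p => M (p + 1) / M p := by
  refine monotone_nat_of_le_succ fun p => ?_
  rw [div_le_div_iff₀ (hM.1 p) (hM.1 _)]
  have := hM.2 (p + 1) (by omega)
  simp only [Nat.add_sub_cancel] at this
  nlinarith

theorem IsM1.mul_le (hM : IsM1 M) (n m : ℕ) : M n * M m ≤ M 0 * M (n + m) := by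
  induction m with
  | zero => simp [mul_comm]
  | succ m ih =>
    have h := hM.monotone_ratio (Nat.le_add_left m n)
    have e : ∀ p, M (p + 1) = M p * (M (p + 1) / M p) := fun p => by
      have := (hM.1 p).ne'
      field_simp
    have hr : 0 ≤ M (m + 1) / M m := (div_pos (hM.1 _) (hM.1 _)).le
    calc M n * M (m + 1) = M n * M m * (M (m + 1) / M m) := by rw [mul_assoc, ← e]
      _ ≤ M 0 * M (n + m) * (M (n + m + 1) / M (n + m)) :=
        mul_le_mul ih h hr (mul_pos (hM.1 _) (hM.1 _)).le
      _ = M 0 * M (n + (m + 1)) := by rw [mul_assoc, ← e, add_assoc]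

theorem IsM1.pow_mul_le_exp_assocFn (hM : IsM1 M) {t : ℝ} (ht : 0 ≤ t)
    (hb : t ≠ 0 → BddAbove (Set.range fun p : ℕ => Real.log (t ^ p * M 0 / M p))) (p : ℕ) :
    t ^ p * M 0 ≤ Real.exp (assocFn M t) * M p := by
  rcases eq_or_ne t 0 with rfl | h0
  · rcases p with _ | p
    · simp [assocFn]
    · simpa [assocFn] using (hM.1 _).le
  · have hpos : 0 < t ^ p * M 0 / M p :=
      div_pos (mul_pos (pow_pos (ht.lt_of_ne' h0) p) (hM.1 0)) (hM.1 p)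
    rw [← div_le_iff₀ (hM.1 p), ← Real.exp_log hpos, assocFn, if_neg h0]
    exact Real.exp_le_exp.2 (le_ciSup (hb h0) p)

theorem IsM1.le_mul_pow_of_not_bddAbove (hM : IsM1 M) {t : ℝ} (ht : 0 < t)
    (hb : ¬ BddAbove (Set.range fun p : ℕ => Real.log (t ^ p * M 0 / M p))) (p : ℕ) :
    M p ≤ M 0 * t ^ p := by
  have hratio : ∀ p, M (p + 1) ≤ t * M p := by
    by_contra! h
    obtain ⟨p, hp⟩ := h
    apply hb
    have hpos : ∀ q, 0 < t ^ q * M 0 / M q := fun q =>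
      div_pos (mul_pos (pow_pos ht q) (hM.1 0)) (hM.1 q)
    have hanti : ∀ q, Real.log (t ^ (p + (q + 1)) * M 0 / M (p + (q + 1))) ≤
        Real.log (t ^ (p + q) * M 0 / M (p + q)) := by
      intro q
      refine Real.log_le_log (hpos _) ?_
      have h1 := hM.monotone_ratio (Nat.le_add_right p q)
      have h2 : t ≤ M (p + q + 1) / M (p + q) :=
        ((lt_div_iff₀ (hM.1 p)).2 hp).le.trans h1
      rw [le_div_iff₀ (hM.1 _)] at h2
      rw [div_le_div_iff₀ (hM.1 _) (hM.1 _), ← add_assoc, pow_succ]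
      have := mul_le_mul_of_nonneg_left h2 (mul_pos (pow_pos ht (p + q)) (hM.1 0)).le
      nlinarith
    have htail : BddAbove (Set.range fun q : ℕ => Real.log (t ^ (p + q) * M 0 / M (p + q))) := by
      have h := antitone_nat_of_succ_le
        (f := fun q => Real.log (t ^ (p + q) * M 0 / M (p + q))) hanti
      exact ⟨_, Set.forall_mem_range.2 fun q => h (Nat.zero_le q)⟩
    have hhead : BddAbove ((fun q : ℕ => Real.log (t ^ q * M 0 / M q)) '' Set.Iio p) :=
      ((Set.finite_Iio p).image _).bddAbove
    refine (hhead.union htail).mono ?_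
    rintro _ ⟨q, rfl⟩
    rcases lt_or_ge q p with h | h
    · exact Or.inl ⟨q, h, rfl⟩
    · obtain ⟨k, rfl⟩ := Nat.exists_eq_add_of_le h
      exact Or.inr ⟨k, rfl⟩
  induction p with
  | zero => simp
  | succ p ih =>
    calc M (p + 1) ≤ t * M p := hratio p
      _ ≤ t * (M 0 * t ^ p) := by gcongr
      _ = M 0 * t ^ (p + 1) := by ring

end LogConvexity

section Modulation

/-- The composition of the operators `∂_i + c_i` over the directions listed in `L`. -/
def modPderList (c : Fin d → ℂ) (L : List (Fin d)) (f : Rd d → ℂ) : Rd d → ℂ :=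
  L.foldr (fun i g t => pder i g t + c i * g t) f

theorem ContDiff.modPderList {f : Rd d → ℂ} (hf : ContDiff ℝ (⊤ : ℕ∞) f) (c : Fin d → ℂ)
    (L : List (Fin d)) : ContDiff ℝ (⊤ : ℕ∞) (modPderList c L f) := by
  induction L with
  | nil => exact hf
  | cons i L ih => exact (ih.pder i).add (contDiff_const.mul ih)

theorem norm_pderList_modPderList_le {f : Rd d → ℂ} (hf : ContDiff ℝ (⊤ : ℕ∞) f)
    {c : Fin d → ℂ} {s : ℝ} (hs : 0 ≤ s) (hc : ∀ i, ‖c i‖ ≤ s) {b : ℕ → ℝ} {x : Rd d}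
    (hb : ∀ (L : List (Fin d)) (m : ℕ), s ^ m * ‖pderList L f x‖ ≤ b (L.length + m))
    (L L' : List (Fin d)) (m : ℕ) :
    s ^ m * ‖pderList L (modPderList c L' f) x‖ ≤
      2 ^ L'.length * b (L.length + L'.length + m) := by
  induction L' generalizing L m with
  | nil => simpa [modPderList] using hb L m
  | cons i L' ih =>
    have hg := hf.modPderList c L'
    have h1 : pderList L (modPderList c (i :: L') f) x =
        pderList (L ++ [i]) (modPderList c L' f) x + c i * pderList L (modPderList c L' f) x := by
      have := congrFun (pderList_add_const_mul (hg.pder i) hg (c i) L) x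
      simpa [pderList, modPderList] using this
    have h2 := ih (L ++ [i]) m
    have h3 := ih L (m + 1)
    have e1 : (L ++ [i]).length + L'.length + m = L.length + (i :: L').length + m := by
      simp only [List.length_append, List.length_cons, List.length_nil]; ring
    have e2 : L.length + L'.length + (m + 1) = L.length + (i :: L').length + m := by
      simp only [List.length_cons]; ring
    rw [e1] at h2
    rw [e2] at h3
    have hsm := pow_nonneg hs m
    calc s ^ m * ‖pderList L (modPderList c (i :: L') f) x‖
        ≤ s ^ m * (‖pderList (L ++ [i]) (modPderList c L' f) x‖ +
            s * ‖pderList L (modPderList c L' f) x‖) := by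
          rw [h1]
          refine mul_le_mul_of_nonneg_left ((norm_add_le _ _).trans ?_) hsm
          rw [norm_mul]
          gcongr
          exact hc i
      _ = s ^ m * ‖pderList (L ++ [i]) (modPderList c L' f) x‖ +
            s ^ (m + 1) * ‖pderList L (modPderList c L' f) x‖ := by ring
      _ ≤ _ := add_le_add h2 h3
      _ = _ := by rw [List.length_cons, pow_succ]; ring

theorem hasFDerivAt_dotR (ξ t : Rd d) : HasFDerivAt (dotR ξ) (innerSL ℝ ξ) t := by
  have h : dotR ξ = innerSL ℝ ξ := by
    funext t
    simp [dotR, PiLp.inner_apply, mul_comm]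
  rw [h]
  exact (innerSL ℝ ξ).hasFDerivAt

theorem contDiff_dotR (ξ : Rd d) : ContDiff ℝ (⊤ : ℕ∞) (dotR ξ) := by
  unfold dotR
  fun_prop

/-- The character `t ↦ e^{-2πi ξ·t}`. -/
def charFn (ξ : Rd d) (t : Rd d) : ℂ :=
  Complex.exp (-(2 * Real.pi * dotR ξ t : ℝ) * Complex.I)

theorem contDiff_charFn (ξ : Rd d) : ContDiff ℝ (⊤ : ℕ∞) (charFn ξ) := by
  have h : ContDiff ℝ (⊤ : ℕ∞) fun t => ((2 * Real.pi * dotR ξ t : ℝ) : ℂ) :=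
    Complex.ofRealCLM.contDiff.comp (contDiff_const.mul (contDiff_dotR ξ))
  exact (h.neg.mul contDiff_const).cexp

theorem norm_charFn (ξ t : Rd d) : ‖charFn ξ t‖ = 1 := by
  rw [charFn, ← Complex.ofReal_neg, Complex.norm_exp_ofReal_mul_I]

theorem pder_charFn (ξ : Rd d) (i : Fin d) (t : Rd d) :
    pder i (charFn ξ) t = -(2 * Real.pi * ξ i : ℝ) * Complex.I * charFn ξ t := by
  have h := ((Complex.ofRealCLM.hasFDerivAt.comp t
    ((hasFDerivAt_dotR ξ t).const_mul (2 * Real.pi))).neg.mul_const Complex.I).cexp.fderiv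
  change fderiv ℝ (charFn ξ) t = _ at h
  rw [pder, h]
  simp [charFn, mul_comm, PiLp.inner_apply]

theorem pderList_mul_charFn {f : Rd d → ℂ} (hf : ContDiff ℝ (⊤ : ℕ∞) f) (ξ : Rd d)
    (L : List (Fin d)) :
    pderList L (fun t => f t * charFn ξ t) = fun t =>
      modPderList (fun i => -(2 * Real.pi * ξ i : ℝ) * Complex.I) L f t * charFn ξ t := by
  induction L with
  | nil => rfl
  | cons i L ih =>
    change pder i (pderList L fun t => f t * charFn ξ t) = _
    rw [ih]
    funext t
    set c : Fin d → ℂ := fun i => -(2 * Real.pi * ξ i : ℝ) * Complex.I with hc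
    have h := (((hf.modPderList c L).differentiable (by simp) t).hasFDerivAt.mul
      ((contDiff_charFn ξ).differentiable (by simp) t).hasFDerivAt).fderiv
    change fderiv ℝ (fun t => modPderList c L f t * charFn ξ t) t = _ at h
    have h' := pder_charFn ξ i t
    rw [pder] at h' ⊢
    rw [h]
    simp only [add_apply, smul_apply, smul_eq_mul, h']
    simp only [modPderList, List.foldr_cons, pder, hc]
    ring

end Modulation

section Vanishing

theorem norm_le_of_norm_pder_le {f : Rd d → ℂ} (hf : ContDiff ℝ (⊤ : ℕ∞) f) (i : Fin d)
    {R A : ℝ} (hR : 0 ≤ R) (hsupp : tsupport f ⊆ Metric.closedBall 0 R)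
    (hA : ∀ x, ‖pder i f x‖ ≤ A) (x : Rd d) : ‖f x‖ ≤ A * (2 * R + 1) := by
  have hA0 : 0 ≤ A := (norm_nonneg _).trans (hA x)
  by_cases hx : x ∈ tsupport f
  · have hxR : ‖x‖ ≤ R := by simpa using hsupp hx
    set e : Rd d := EuclideanSpace.single i 1 with he
    have hen : ‖e‖ = 1 := by simp [he]
    have hder : ∀ s : ℝ, HasDerivAt (fun s : ℝ => f (x + s • e)) (pder i f (x + s • e)) s := by
      intro s
      have h1 : HasDerivAt (fun s : ℝ => x + s • e) e s := by
        simpa using ((hasDerivAt_id s).smul_const e).const_add x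
      exact (hf.differentiable (by simp) (x + s • e)).hasFDerivAt.comp_hasDerivAt s h1
    have hmv := Convex.norm_image_sub_le_of_norm_deriv_le (𝕜 := ℝ) (s := Set.univ)
      (x := 2 * R + 1) (y := 0) (C := A) (fun s _ => (hder s).differentiableAt)
      (fun s _ => by rw [(hder s).deriv]; exact hA _) convex_univ trivial trivial
    have hfar : f (x + (2 * R + 1) • e) = 0 := by
      by_contra h
      have h1 : ‖x + (2 * R + 1) • e‖ ≤ R := by simpa using hsupp (subset_tsupport f h)
      have h2 : ‖(2 * R + 1) • e‖ = 2 * R + 1 := by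
        rw [norm_smul, hen, Real.norm_of_nonneg (by linarith), mul_one]
      have h3 := norm_sub_le (x + (2 * R + 1) • e) x
      rw [add_sub_cancel_left, h2] at h3
      linarith
    rwa [hfar, zero_smul, add_zero, sub_zero, zero_sub, norm_neg,
      Real.norm_of_nonneg (by linarith)] at hmv
  · rw [image_eq_zero_of_notMem_tsupport hx, norm_zero]
    exact mul_nonneg hA0 (by linarith)

theorem eq_zero_of_norm_pderList_le {f : Rd d → ℂ} (hf : ContDiff ℝ (⊤ : ℕ∞) f) (i : Fin d)
    {R B q : ℝ} (hR : 0 ≤ R) (hsupp : tsupport f ⊆ Metric.closedBall 0 R)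
    (hq : 0 ≤ q) (hq1 : q * (2 * R + 1) < 1)
    (hB : ∀ L x, ‖pderList L f x‖ ≤ B * q ^ L.length) : f = 0 := by
  have key : ∀ (n : ℕ) (L : List (Fin d)) (x : Rd d),
      ‖pderList L f x‖ ≤ B * q ^ (n + L.length) * (2 * R + 1) ^ n := by
    intro n
    induction n with
    | zero => simpa using hB
    | succ n ih =>
      intro L x
      have := norm_le_of_norm_pder_le (hf.pderList L) i hR
        ((tsupport_pderList_subset L f).trans hsupp) (ih (i :: L)) x
      refine this.trans_eq ?_
      rw [List.length_cons]
      ring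
  funext x
  have hlim : Filter.Tendsto (fun n : ℕ => B * (q * (2 * R + 1)) ^ n) Filter.atTop (nhds 0) := by
    simpa using (tendsto_pow_atTop_nhds_zero_of_lt_one (by positivity) hq1).const_mul B
  have hle : ‖f x‖ ≤ 0 := ge_of_tendsto' hlim fun n => by
    simpa [mul_pow, mul_assoc, pderList] using key n [] x
  simpa using hle

end Vanishing

section Dual

variable {M : ℕ → ℝ}

theorem EnormFin.exists_norm_pderList_le (hM : IsM1 M) {ℓ : ℝ} (hℓ : 0 < ℓ) {φ : Rd d → ℂ}
    (hφ : ContDiff ℝ (⊤ : ℕ∞) φ) (h : EnormFin M ℓ (tsupport φ) φ) :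
    ∃ B > (0 : ℝ), ∀ L x, ‖pderList L φ x‖ ≤ B * (ℓ ^ L.length * M L.length) := by
  obtain ⟨K, hK⟩ := h
  refine ⟨|K| + 1, by positivity, fun L x => ?_⟩
  have hpos : 0 < ℓ ^ L.length * M L.length := mul_pos (pow_pos hℓ _) (hM.1 _)
  by_cases hx : x ∈ tsupport φ
  · obtain ⟨α, hα, hαL⟩ := exists_mderiv_eq_pderList hφ L
    have := hK ⟨α, x, hx, rfl⟩
    rw [hα, hαL, div_le_iff₀ hpos] at this
    refine this.trans (mul_le_mul_of_nonneg_right ?_ hpos.le)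
    linarith [le_abs_self K]
  · rw [image_eq_zero_of_notMem_tsupport fun h => hx (tsupport_pderList_subset L φ h), norm_zero]
    positivity

theorem Fdualnorm_nonneg (ω : Rd d → ℝ) (ℓ : ℝ) (f : (Rd d → ℂ) →ₗ[ℂ] ℂ) :
    0 ≤ Fdualnorm M ω ℓ f :=
  Real.sSup_nonneg fun _ ⟨_, _, _, _, h⟩ => h ▸ norm_nonneg _

theorem norm_apply_le_Fdualnorm_mul {ω : Rd d → ℝ} {ℓ : ℝ}
    {f : (Rd d → ℂ) →ₗ[ℂ] ℂ} (hf : BddAbove (FdualSet M ω ℓ f)) {g : Rd d → ℂ}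
    (hg : ContDiff ℝ (⊤ : ℕ∞) g)
    (hint : ∀ α : Fin d → ℕ, Integrable fun x => ‖mderiv α g x‖ * ω x)
    {A : ℝ} (hA : 0 < A) (hle : ∀ r ∈ DL1Set M ω ℓ g, r ≤ A) :
    ‖f g‖ ≤ Fdualnorm M ω ℓ f * A := by
  set c : ℂ := ((A⁻¹ : ℝ) : ℂ) with hc
  have hcn : ‖c‖ = A⁻¹ := by rw [hc, Complex.norm_real, Real.norm_of_nonneg (by positivity)]
  have hder : ∀ (α : Fin d → ℕ) (x : Rd d), ‖mderiv α (c • g) x‖ = A⁻¹ * ‖mderiv α g x‖ := by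
    intro α x
    have h0 : ∀ (L : List (Fin d)) (x : Rd d), pderList L (fun _ : Rd d => (0 : ℂ)) x = 0 := by
      intro L x
      refine image_eq_zero_of_notMem_tsupport fun h => ?_
      simpa [tsupport] using tsupport_pderList_subset L _ h
    have h := congrFun (pderList_add_const_mul (contDiff_const (c := (0 : ℂ))) hg c (dirList α)) x
    simp only [h0, zero_add] at h
    rw [mderiv_eq_pderList, mderiv_eq_pderList, ← hcn, ← norm_mul, ← h]
    rfl
  have hle' : ∀ r ∈ DL1Set M ω ℓ (c • g), r ≤ 1 := by
    rintro _ ⟨α, rfl⟩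
    have h := hle _ ⟨α, rfl⟩
    simp only [hder, mul_assoc, integral_const_mul]
    rw [mul_div_assoc, inv_mul_le_iff₀ hA, mul_one]
    exact h
  have hmem : ‖f (c • g)‖ ∈ FdualSet M ω ℓ f := by
    refine ⟨c • g, contDiff_const.smul hg, ⟨fun α => ?_, 1, hle'⟩, ?_, rfl⟩
    · simp only [hder, mul_assoc]
      exact (hint α).const_mul _
    · exact csSup_le ⟨_, 0, rfl⟩ hle'
  have h := le_csSup hf hmem
  rw [map_smul, norm_smul, hcn, inv_mul_le_iff₀ hA] at h
  rw [mul_comm]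
  exact h

theorem norm_apply_le_of_norm_pderList_le (hM : IsM1 M) {ω : Rd d → ℝ} (hω0 : ∀ x, 0 < ω x)
    (hωm : Measurable ω) {R C : ℝ} (hC : 0 < C)
    (hωC : ∀ x h : Rd d, ‖h‖ ≤ R → ω (x + h) ≤ C * ω x) {ℓ : ℝ} (hℓ : 0 < ℓ)
    {f : (Rd d → ℂ) →ₗ[ℂ] ℂ} (hf : BddAbove (FdualSet M ω ℓ f)) {g : Rd d → ℂ}
    (hg : ContDiff ℝ (⊤ : ℕ∞) g) {x : Rd d} (hsupp : Function.support g ⊆ Metric.closedBall x R)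
    {B : ℝ} (hB : 0 < B)
    (hle : ∀ L t, ‖pderList L g t‖ ≤ B * (ℓ ^ L.length * M L.length)) :
    ‖f g‖ ≤ Fdualnorm M ω ℓ f *
      (B * C * (volume.real (Metric.closedBall (0 : Rd d) R) + 1) * ω x) := by
  have hts : tsupport g ⊆ Metric.closedBall x R :=
    closure_minimal hsupp Metric.isClosed_closedBall
  set V := volume.real (Metric.closedBall (0 : Rd d) R) with hV
  have hV0 : 0 ≤ V := measureReal_nonneg
  have hωx := hω0 x
  set N : (Fin d → ℕ) → ℝ := fun α => ℓ ^ mOrd α * M (mOrd α) with hN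
  have hN0 : ∀ α, 0 < N α := fun α => mul_pos (pow_pos hℓ _) (hM.1 _)
  have hpt : ∀ α t, ‖‖mderiv α g t‖ * ω t‖ ≤
      (Metric.closedBall x R).indicator (fun _ => B * N α * (C * ω x)) t := by
    intro α t
    rw [Real.norm_of_nonneg (mul_nonneg (norm_nonneg _) (hω0 t).le), mderiv_eq_pderList]
    by_cases ht : t ∈ Metric.closedBall x R
    · rw [Set.indicator_of_mem ht]
      have h1 := hle (dirList α) t
      rw [length_dirList] at h1
      have h2 := hωC x (t - x) (by rwa [← dist_eq_norm])
      rw [add_sub_cancel] at h2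
      exact mul_le_mul h1 h2 (hω0 t).le (mul_pos hB (hN0 α)).le
    · rw [Set.indicator_of_notMem ht, image_eq_zero_of_notMem_tsupport
        fun h => ht (hts (tsupport_pderList_subset _ g h))]
      simp
  have hind : ∀ α, Integrable
      ((Metric.closedBall x R).indicator fun _ => B * N α * (C * ω x)) volume := fun α =>
    (integrable_indicator_iff measurableSet_closedBall).2
      (integrableOn_const measure_closedBall_lt_top.ne)
  have hint : ∀ α : Fin d → ℕ, Integrable fun t => ‖mderiv α g t‖ * ω t := by
    intro α
    refine (hind α).mono' ?_ (Filter.Eventually.of_forall (hpt α))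
    have hm : Measurable (mderiv α g) := by
      rw [mderiv_eq_pderList]
      exact (hg.pderList _).continuous.measurable
    exact (hm.norm.mul hωm).aestronglyMeasurable
  refine norm_apply_le_Fdualnorm_mul hf hg hint (by positivity) ?_
  rintro _ ⟨α, rfl⟩
  rw [div_le_iff₀ (hN0 α)]
  calc ∫ t, ‖mderiv α g t‖ * ω t
      ≤ ∫ t, (Metric.closedBall x R).indicator (fun _ => B * N α * (C * ω x)) t :=
        integral_mono (hint α) (hind α) fun t => (le_abs_self _).trans (hpt α t)
    _ = V * (B * N α * (C * ω x)) := by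
        rw [integral_indicator_const _ measurableSet_closedBall, smul_eq_mul, hV,
          measureReal_def, measureReal_def, Measure.addHaar_closedBall_center]
    _ ≤ (V + 1) * (B * N α * (C * ω x)) := by
        have := hN0 α
        gcongr
        linarith
    _ = B * C * (V + 1) * ω x * (ℓ ^ mOrd α * M (mOrd α)) := by rw [hN]; ring

end Dual

section Window

variable {M : ℕ → ℝ}

theorem IsTestD.eq_zero_of_not_bddAbove (hM : IsM1 M) {ψ : Rd d → ℂ} (hψ : IsTestD M ψ)
    (i : Fin d) {t : ℝ} (ht : 0 < t)
    (hb : ¬ BddAbove (Set.range fun p : ℕ => Real.log (t ^ p * M 0 / M p))) : ψ = 0 := by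
  obtain ⟨R, hR, hsupp⟩ := hψ.2.1.isCompact.isBounded.subset_closedBall_lt 0 0
  have hq : 0 < 2 * (2 * R + 1) * t := by positivity
  obtain ⟨B, hB, hle⟩ := (hψ.2.2 _ (inv_pos.2 hq)).exists_norm_pderList_le hM (inv_pos.2 hq) hψ.1
  refine eq_zero_of_norm_pderList_le (q := (2 * (2 * R + 1) * t)⁻¹ * t) (B := B * M 0) hψ.1 i hR.le
    hsupp (by positivity) ?_ fun L x => (hle L x).trans ?_
  · have : (2 * (2 * R + 1) * t)⁻¹ * t * (2 * R + 1) = 1 / 2 := by field_simp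
    rw [this]
    norm_num
  · rw [mul_pow, mul_assoc B]
    refine mul_le_mul_of_nonneg_left ?_ hB.le
    have := mul_le_mul_of_nonneg_left (hM.le_mul_pow_of_not_bddAbove ht hb L.length)
      (pow_pos (inv_pos.2 hq) L.length).le
    exact this.trans_eq (by ring)

theorem windowFn_eq (ψ : Rd d → ℂ) (x ξ : Rd d) :
    windowFn ψ x ξ = fun t => (starRingEnd ℂ) (ψ (t - x)) * charFn ξ t := rfl

theorem contDiff_conj_comp_sub {ψ : Rd d → ℂ} (hψ : ContDiff ℝ (⊤ : ℕ∞) ψ) (x : Rd d) :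
    ContDiff ℝ (⊤ : ℕ∞) fun t => (starRingEnd ℂ) (ψ (t - x)) :=
  Complex.conjCLE.contDiff.comp (hψ.comp (contDiff_id.sub contDiff_const))

theorem norm_pderList_windowFn_le (hM : IsM1 M) {ℓ : ℝ} (hℓ : 0 < ℓ) {ψ : Rd d → ℂ}
    (hψ : ContDiff ℝ (⊤ : ℕ∞) ψ) {B : ℝ} (hB : 0 < B)
    (hle : ∀ L x, ‖pderList L ψ x‖ ≤ B * ((ℓ / 2) ^ L.length * M L.length)) (x ξ : Rd d)
    {E : ℝ} (hE : ∀ p, (4 * Real.pi * ‖ξ‖ / ℓ) ^ p * M 0 ≤ E * M p)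
    (L : List (Fin d)) (t : Rd d) :
    ‖pderList L (windowFn ψ x ξ) t‖ ≤ B * E * (ℓ ^ L.length * M L.length) := by
  have hsm := contDiff_conj_comp_sub hψ x
  have hE0 : 0 ≤ E := by
    have := hE 0
    rw [pow_zero] at this
    exact zero_le_one.trans (le_of_mul_le_mul_right this (hM.1 0))
  have hc : ∀ i, ‖-((2 * Real.pi * ξ i : ℝ) : ℂ) * Complex.I‖ ≤ 2 * Real.pi * ‖ξ‖ := by
    intro i
    rw [norm_mul, Complex.norm_I, mul_one, norm_neg, Complex.norm_real, norm_mul,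
      Real.norm_of_nonneg Real.two_pi_pos.le]
    gcongr
    exact PiLp.norm_apply_le ξ i
  have h := norm_pderList_modPderList_le hsm (s := 2 * Real.pi * ‖ξ‖) (by positivity) hc
    (b := fun N => B * E * ((ℓ / 2) ^ N * M N)) (x := t) ?_ [] L 0
  · rw [windowFn_eq, pderList_mul_charFn hsm, norm_mul, norm_charFn, mul_one]
    simp only [pow_zero, one_mul, List.length_nil, zero_add, add_zero] at h
    refine h.trans_eq ?_
    rw [div_pow]
    field_simp
  · intro L m
    rw [pderList_conj_comp_sub, RCLike.norm_conj]
    have h1 := hle L (t - x)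
    have h2 : (2 * Real.pi * ‖ξ‖) ^ m = (ℓ / 2) ^ m * (4 * Real.pi * ‖ξ‖ / ℓ) ^ m := by
      rw [← mul_pow]
      congr 1
      field_simp
      ring
    have h3 : (4 * Real.pi * ‖ξ‖ / ℓ) ^ m * M L.length ≤ E * M (L.length + m) := by
      have h4 := mul_le_mul_of_nonneg_right (hE m) (hM.1 L.length).le
      have h5 := mul_le_mul_of_nonneg_left (hM.mul_le L.length m) hE0
      refine le_of_mul_le_mul_right ?_ (hM.1 0)
      linarith
    calc (2 * Real.pi * ‖ξ‖) ^ m * ‖pderList L ψ (t - x)‖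
        ≤ (2 * Real.pi * ‖ξ‖) ^ m * (B * ((ℓ / 2) ^ L.length * M L.length)) := by gcongr
      _ = B * (ℓ / 2) ^ (L.length + m) * ((4 * Real.pi * ‖ξ‖ / ℓ) ^ m * M L.length) := by
        rw [h2, pow_add]; ring
      _ ≤ B * (ℓ / 2) ^ (L.length + m) * (E * M (L.length + m)) := by gcongr
      _ = B * E * ((ℓ / 2) ^ (L.length + m) * M (L.length + m)) := by ring

end Window

/-- bounds for convolution averages and for the STFT of elements of
`(D^{M_p,ℓ}_{L¹_ω})'`, with constants independent of `f`. -/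
theorem stmt5 {d : ℕ} (M : ℕ → ℝ) (hM1 : IsM1 M)
    (ω : Rd d → ℝ) (hω : OmegaCond ω) (ℓ : ℝ) (hℓ : 0 < ℓ) :
    (∀ φ : Rd d → ℂ, ContDiff ℝ (⊤ : ℕ∞) φ → HasCompactSupport φ →
      EnormFin M ℓ (tsupport φ) φ →
      ∃ C > (0 : ℝ), ∀ f : (Rd d → ℂ) →ₗ[ℂ] ℂ, BddAbove (FdualSet M ω ℓ f) →
        ∀ x : Rd d, ‖f (fun t => φ (x - t))‖ ≤ C * Fdualnorm M ω ℓ f * ω x) ∧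
    (∀ ψ : Rd d → ℂ, IsTestD M ψ →
      ∃ C > (0 : ℝ), ∀ f : (Rd d → ℂ) →ₗ[ℂ] ℂ, BddAbove (FdualSet M ω ℓ f) →
        ∀ x ξ : Rd d, ‖STFTd f ψ x ξ‖ ≤
          C * Fdualnorm M ω ℓ f * ω x * Real.exp (assocFn M (4 * Real.pi * ‖ξ‖ / ℓ))) := by
  obtain ⟨hω0, hωm, hωR⟩ := hω
  constructor
  · intro φ hφ hφc hφE
    obtain ⟨R, hR, hsupp⟩ := hφc.isCompact.isBounded.subset_closedBall_lt 0 0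
    obtain ⟨C, hC, hωC⟩ := hωR R hR
    obtain ⟨B, hB, hle⟩ := hφE.exists_norm_pderList_le hM1 hℓ hφ
    refine ⟨B * C * (volume.real (Metric.closedBall (0 : Rd d) R) + 1), by positivity,
      fun f hf x => ?_⟩
    refine (norm_apply_le_of_norm_pderList_le hM1 hω0 hωm hC hωC hℓ hf (x := x)
      (hφ.comp (contDiff_const.sub contDiff_id)) (fun t ht => ?_) hB fun L t => ?_).trans_eq
      (by ring)
    · simpa [dist_eq_norm, norm_sub_rev] using hsupp (subset_tsupport φ ht)
    · have h := congrFun (pderList_comp_const_sub hφ x L) t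
      change pderList L (φ ∘ fun t => x - t) t = _ at h
      rw [Function.comp_def] at h
      simpa [Function.comp_def, h] using hle L (x - t)
  · intro ψ hψ
    obtain ⟨R, hR, hsupp⟩ := hψ.2.1.isCompact.isBounded.subset_closedBall_lt 0 0
    obtain ⟨C, hC, hωC⟩ := hωR R hR
    obtain ⟨B, hB, hle⟩ :=
      (hψ.2.2 (ℓ / 2) (by positivity)).exists_norm_pderList_le hM1 (by positivity) hψ.1
    refine ⟨B * C * (volume.real (Metric.closedBall (0 : Rd d) R) + 1), by positivity,
      fun f hf x ξ => ?_⟩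
    by_cases hb : 4 * Real.pi * ‖ξ‖ / ℓ ≠ 0 →
        BddAbove (Set.range fun p : ℕ => Real.log ((4 * Real.pi * ‖ξ‖ / ℓ) ^ p * M 0 / M p))
    · refine (norm_apply_le_of_norm_pderList_le hM1 hω0 hωm hC hωC hℓ hf (x := x)
        ((contDiff_conj_comp_sub hψ.1 x).mul (contDiff_charFn ξ)) (fun t ht => ?_)
        (mul_pos hB (Real.exp_pos _))
        (norm_pderList_windowFn_le hM1 hℓ hψ.1 hB hle x ξ
          (hM1.pow_mul_le_exp_assocFn (by positivity) hb))).trans_eq (by ring)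
      have : ψ (t - x) ≠ 0 := fun h => ht (by simp [h])
      simpa [dist_eq_norm] using hsupp (subset_tsupport ψ this)
    · push Not at hb
      have hi : Nonempty (Fin d) := by
        by_contra h
        rw [not_nonempty_iff] at h
        exact hb.1 (by simp [Subsingleton.elim ξ 0])
      obtain ⟨i⟩ := hi
      have hψ0 := hψ.eq_zero_of_not_bddAbove hM1 i
        ((show 0 ≤ 4 * Real.pi * ‖ξ‖ / ℓ by positivity).lt_of_ne' hb.1) hb.2
      have hw : windowFn ψ x ξ = 0 := by
        funext t
        simp [windowFn, hψ0]
      rw [STFTd, hw, map_zero, norm_zero]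
      have := Fdualnorm_nonneg (M := M) ω ℓ f
      have := hω0 x
      positivity
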